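/- Cubic von Neumann rule: if Q is an admissible quantization of (Õ, P¹), then there exist real constants a and c such that Q(S_i³) = a·Q(S_i)³ + c·Q(S_i) for i = 1,2,3; Q(S_i S_ℓ S_i) = a·Q(S_i)Q(S_ℓ)Q(S_i) + (1/3)(a+c)·Q(S_ℓ) for all i ≠ ℓ; and Q(S₁S₂S₃) = a·Q(S₁)Q(S₂)Q(S₃) + (a/(2i))·(Q(S₁)² − Q(S₂)² + Q(S₃)²). -/

import Mathlib

open MvPolynomial MeasureTheory

noncomputable section

attribute [local instance] Classical.propDecidable

/-- The Poisson bracket on `ℝ[X₀,X₁,X₂]` associated to the sphere: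
`{f,g} = Σ εᵢⱼₖ Xᵢ ∂f/∂Xⱼ ∂g/∂Xₖ` (indices `0,1,2` play the role of `1,2,3`). -/
def pb (f g : MvPolynomial (Fin 3) ℝ) : MvPolynomial (Fin 3) ℝ :=
  X 0 * (pderiv 1 f * pderiv 2 g - pderiv 2 f * pderiv 1 g) +
  X 1 * (pderiv 2 f * pderiv 0 g - pderiv 0 f * pderiv 2 g) +
  X 2 * (pderiv 0 f * pderiv 1 g - pderiv 1 f * pderiv 0 g)

/-- The ideal generated by `X₀² + X₁² + X₂² - s²`. -/
def sphereIdeal (s : ℝ) : Ideal (MvPolynomial (Fin 3) ℝ) :=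
  Ideal.span {X 0 ^ 2 + X 1 ^ 2 + X 2 ^ 2 - C (s ^ 2)}

/-- The Poisson algebra `P` of polynomial functions on the sphere of radius `s`. -/
abbrev SpherePoly (s : ℝ) := MvPolynomial (Fin 3) ℝ ⧸ sphereIdeal s

/-- The quotient map `ℝ[X₀,X₁,X₂] → P`. -/
def toSphere (s : ℝ) : MvPolynomial (Fin 3) ℝ →+* SpherePoly s :=
  Ideal.Quotient.mk (sphereIdeal s)

/-- The components `S₁, S₂, S₃` of the spin vector (indexed by `Fin 3`). -/
def S (s : ℝ) (i : Fin 3) : SpherePoly s := toSphere s (X i)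

/-- A choice of polynomial representative of an element of `P`. -/
def rep (s : ℝ) (p : SpherePoly s) : MvPolynomial (Fin 3) ℝ :=
  (Ideal.Quotient.mk_surjective (I := sphereIdeal s) p).choose

/-- The Poisson bracket descended to `P`.  (It is independent of the choice of
representatives, since the bracket of any polynomial with the generator
`X₀² + X₁² + X₂² - s²` vanishes identically.) -/
def pbS (s : ℝ) (p q : SpherePoly s) : SpherePoly s :=
  toSphere s (pb (rep s p) (rep s q))

/-- The Laplacian on `ℝ[X₀,X₁,X₂]` as a linear map. -/
def laplacian : MvPolynomial (Fin 3) ℝ →ₗ[ℝ] MvPolynomial (Fin 3) ℝ :=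
  (pderiv 0).toLinearMap ∘ₗ (pderiv 0).toLinearMap +
  (pderiv 1).toLinearMap ∘ₗ (pderiv 1).toLinearMap +
  (pderiv 2).toLinearMap ∘ₗ (pderiv 2).toLinearMap

/-- Homogeneous harmonic polynomials of degree `l`. -/
def harmonicHomog (l : ℕ) : Submodule ℝ (MvPolynomial (Fin 3) ℝ) :=
  homogeneousSubmodule (Fin 3) ℝ l ⊓ LinearMap.ker laplacian

/-- `H_l`, the image in `P` of the homogeneous harmonic polynomials of degree `l`. -/
def Hsph (s : ℝ) (l : ℕ) : Submodule ℝ (SpherePoly s) :=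
  (harmonicHomog l).map (Ideal.Quotient.mkₐ ℝ (sphereIdeal s)).toLinearMap

/-- `O`, the odd polynomials: the sum of the `H_l` over odd `l`. -/
def Osph (s : ℝ) : Submodule ℝ (SpherePoly s) :=
  ⨆ (l : ℕ) (_ : Odd l), Hsph s l

/-- `Õ = ℝ·1 ⊕ O`. -/
def Otilde (s : ℝ) : Submodule ℝ (SpherePoly s) :=
  Submodule.span ℝ ({1} : Set (SpherePoly s)) ⊔ Osph s

theorem S_mem_H1 (s : ℝ) (i : Fin 3) : S s i ∈ Hsph s 1 := by
  refine ⟨X i, ⟨isHomogeneous_X _ _, ?_⟩, rfl⟩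
  fin_cases i <;> simp [laplacian, pderiv_X]

theorem S_mem_Otilde (s : ℝ) (i : Fin 3) : S s i ∈ Otilde s :=
  Submodule.mem_sup_right
    ((le_iSup₂ (f := fun (l : ℕ) (_ : Odd l) => Hsph s l) 1 odd_one) (S_mem_H1 s i))

theorem one_mem_Otilde (s : ℝ) : (1 : SpherePoly s) ∈ Otilde s :=
  Submodule.mem_sup_left (Submodule.mem_span_singleton_self 1)

/-- The structure constants of `so(3)`: the totally antisymmetric symbol on three indices. -/
def leviCivita : Fin 3 → Fin 3 → Fin 3 → ℤ :=
  ![![![0, 0, 0], ![0, 0, 1], ![0, -1, 0]],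
    ![![0, 0, -1], ![0, 0, 0], ![1, 0, 0]],
    ![![0, 1, 0], ![-1, 0, 0], ![0, 0, 0]]]

/-- `J` spans a (physicist-normalised) representation of `su(2)`. -/
def IsSpin {E : Type*} [Ring E] [Algebra ℂ E] (J : Fin 3 → E) : Prop :=
  ∀ m i, J m * J i - J i * J m = Complex.I • ∑ l, leviCivita m i l • J l

/-- `D` is a rank three tensor operator with respect to `J`. -/
def IsTensorOperator {E : Type*} [Ring E] [Algebra ℂ E] (J : Fin 3 → E)
    (D : Fin 3 → Fin 3 → Fin 3 → E) : Prop :=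
  ∀ m i j k, J m * D i j k - D i j k * J m =
    Complex.I • ∑ l, (leviCivita m i l • D l j k + leviCivita m j l • D i l k +
      leviCivita m k l • D i j l)

section Algebra

variable {E : Type*} [Ring E] [Algebra ℂ E]

theorem IsTensorOperator.sub_smul {J : Fin 3 → E} {D T : Fin 3 → Fin 3 → Fin 3 → E}
    (hD : IsTensorOperator J D) (hT : IsTensorOperator J T) (α : ℂ) :
    IsTensorOperator J (fun i j k => D i j k - α • T i j k) := by
  intro m i j k
  have h1 := hD m i j k
  have h2 := hT m i j k
  simp only [mul_sub, sub_mul, mul_smul_comm, smul_mul_assoc, Fin.sum_univ_three] at h1 h2 ⊢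
  linear_combination (norm := module) h1 - α • h2

/-- The symmetrised product of three components of `J`. -/
def symCube (J : Fin 3 → E) (i j k : Fin 3) : E :=
  (1 / 6 : ℂ) • (J i * J j * J k + J i * J k * J j + J j * J i * J k + J j * J k * J i +
    J k * J i * J j + J k * J j * J i)

theorem IsSpin.isTensorOperator_mul {J : Fin 3 → E} (hJ : IsSpin J) :
    IsTensorOperator J (fun i j k => J i * J j * J k) := by
  intro m i j k
  have key : J m * (J i * J j * J k) - J i * J j * J k * J m =
      (J m * J i - J i * J m) * J j * J k + J i * (J m * J j - J j * J m) * J k +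
        J i * J j * (J m * J k - J k * J m) := by noncomm_ring
  rw [key, hJ, hJ, hJ]
  simp only [Fin.sum_univ_three, mul_add, add_mul, smul_mul_assoc, mul_smul_comm]
  module

theorem IsSpin.isTensorOperator_symCube {J : Fin 3 → E} (hJ : IsSpin J) :
    IsTensorOperator J (symCube J) := by
  intro m i j k
  have h := hJ.isTensorOperator_mul
  have h1 := h m i j k
  have h2 := h m i k j
  have h3 := h m j i k
  have h4 := h m j k i
  have h5 := h m k i j
  have h6 := h m k j i
  simp only [symCube, mul_add, add_mul, mul_smul_comm, smul_mul_assoc, Fin.sum_univ_three]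
    at h1 h2 h3 h4 h5 h6 ⊢
  linear_combination (norm := module) (1 / 6 : ℂ) • (h1 + h2 + h3 + h4 + h5 + h6)

/-- The commutator with the lowering operator `J 0 - i J 1`. -/
def lowering (J : Fin 3 → E) : E →ₗ[ℂ] E :=
  LinearMap.mulLeft ℂ (J 0) - LinearMap.mulRight ℂ (J 0) -
    Complex.I • (LinearMap.mulLeft ℂ (J 1) - LinearMap.mulRight ℂ (J 1))

theorem lowering_apply (J : Fin 3 → E) (x : E) :
    lowering J x = (J 0 * x - x * J 0) - Complex.I • (J 1 * x - x * J 1) := rfl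

theorem IsTensorOperator.lowering_eq {J : Fin 3 → E} {D : Fin 3 → Fin 3 → Fin 3 → E}
    (hD : IsTensorOperator J D) (i j k : Fin 3) :
    lowering J (D i j k) =
      ∑ l, ((Complex.I * leviCivita 0 i l + leviCivita 1 i l : ℂ) • D l j k +
        (Complex.I * leviCivita 0 j l + leviCivita 1 j l : ℂ) • D i l k +
        (Complex.I * leviCivita 0 k l + leviCivita 1 k l : ℂ) • D i j l) := by
  rw [lowering_apply, hD, hD]
  simp only [Fin.sum_univ_three, ← Int.cast_smul_eq_zsmul ℂ, add_smul]
  have hI : ∀ z : E, Complex.I • Complex.I • z = -z := fun z => by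
    rw [smul_smul, Complex.I_mul_I, neg_one_smul]
  simp only [smul_add, hI, mul_smul]
  module

end Algebra

section TensorOperator

variable {E : Type*} [Ring E] [Algebra ℂ E]

theorem IsSpin.lowering_eq {J : Fin 3 → E} (hJ : IsSpin J) (i : Fin 3) :
    lowering J (J i) = ∑ l, (Complex.I * leviCivita 0 i l + leviCivita 1 i l : ℂ) • J l := by
  have hI : ∀ z : E, Complex.I • Complex.I • z = -z := fun z => by
    rw [smul_smul, Complex.I_mul_I, neg_one_smul]
  rw [lowering_apply, hJ, hJ]
  simp only [Fin.sum_univ_three, ← Int.cast_smul_eq_zsmul ℂ, add_smul]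
  simp only [smul_add, hI, mul_smul]
  module

set_option linter.unusedSimpArgs false in
set_option maxHeartbeats 1000000 in
/-- A symmetric tensor operator of rank three whose traces are multiples of `J` and whose highest
weight component vanishes is determined by its traces. -/
theorem IsTensorOperator.eq_of_highest_eq_zero {J : Fin 3 → E} (hJ : IsSpin J)
    {D : Fin 3 → Fin 3 → Fin 3 → E} (hD : IsTensorOperator J D)
    (hswap : ∀ i j k, D i j k = D j i k) (hswap' : ∀ i j k, D i j k = D i k j)
    (κ : ℂ) (htr : ∀ j, ∑ i, D i i j = κ • J j)
    (htop : D 0 0 0 + (3 * Complex.I) • D 0 0 1 - (3 : ℂ) • D 0 1 1 - Complex.I • D 1 1 1 = 0)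
    (i j k : Fin 3) :
    D i j k = (κ / 5) • ((if i = j then J k else 0) + (if j = k then J i else 0) +
      (if i = k then J j else 0)) := by
  have s1 : D 0 1 0 = D 0 0 1 := hswap' _ _ _
  have s2 : D 1 0 0 = D 0 0 1 := by rw [hswap, hswap']
  have s3 : D 0 2 0 = D 0 0 2 := hswap' _ _ _
  have s4 : D 2 0 0 = D 0 0 2 := by rw [hswap, hswap']
  have s5 : D 1 0 1 = D 0 1 1 := hswap _ _ _
  have s6 : D 1 1 0 = D 0 1 1 := by rw [hswap', hswap]
  have s7 : D 1 2 1 = D 1 1 2 := hswap' _ _ _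
  have s8 : D 2 1 1 = D 1 1 2 := by rw [hswap, hswap']
  have s9 : D 2 0 2 = D 0 2 2 := hswap _ _ _
  have s10 : D 2 2 0 = D 0 2 2 := by rw [hswap', hswap]
  have s11 : D 2 1 2 = D 1 2 2 := hswap _ _ _
  have s12 : D 2 2 1 = D 1 2 2 := by rw [hswap', hswap]
  have s13 : D 0 2 1 = D 0 1 2 := hswap' _ _ _
  have s14 : D 1 0 2 = D 0 1 2 := hswap _ _ _
  have s15 : D 1 2 0 = D 0 1 2 := by rw [hswap', s14]
  have s16 : D 2 0 1 = D 0 1 2 := by rw [hswap, s13]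
  have s17 : D 2 1 0 = D 0 1 2 := by rw [hswap', s16]
  have hL := hD.lowering_eq
  have hLJ := hJ.lowering_eq
  have t0 := htr 0
  have t1 := htr 1
  have t2 := htr 2
  simp only [Fin.sum_univ_three, s1, s2, s3, s4, s5, s6, s7, s8, s9, s10, s11, s12]
    at t0 t1 t2
  simp only [Fin.sum_univ_three] at hL hLJ
  have h2 : D 0 0 2 + (2 * Complex.I) • D 0 1 2 - D 1 1 2 = 0 := by
    have h := congrArg (lowering J) htop
    simp [hL, leviCivita, s1, s2, s3, s4, s5, s6, s7, s8, s9, s10, s11, s12, s13, s14, s15,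
      s16, s17] at h
    linear_combination (norm := skip) (-1 / 6 : ℂ) • h
    match_scalars <;> grind [Complex.I_mul_I]
  have h1 : D 0 2 2 + Complex.I • D 1 2 2 = (κ / 5) • (J 0 + Complex.I • J 1) := by
    have h := congrArg (lowering J) h2
    simp [hL, leviCivita, s1, s2, s3, s4, s5, s6, s7, s8, s9, s10, s11, s12, s13, s14, s15,
      s16, s17] at h
    linear_combination (norm := skip)
      (-1 / 5 : ℂ) • h + (1 / 5 : ℂ) • t0 + (Complex.I / 5) • t1
    match_scalars <;> grind [Complex.I_mul_I]
  have h0 : D 2 2 2 = (3 * κ / 5) • J 2 := by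
    have h := congrArg (lowering J) h1
    simp [hL, hLJ, leviCivita, s1, s2, s3, s4, s5, s6, s7, s8, s9, s10, s11, s12, s13, s14, s15,
      s16, s17] at h
    linear_combination (norm := skip) (-1 / 4 : ℂ) • h + (1 / 2 : ℂ) • t2
    match_scalars <;> grind [Complex.I_mul_I]
  have h1' : D 0 2 2 - Complex.I • D 1 2 2 = (κ / 5) • (J 0 - Complex.I • J 1) := by
    have h := congrArg (lowering J) h0
    simp [hL, hLJ, leviCivita, s1, s2, s3, s4, s5, s6, s7, s8, s9, s10, s11, s12, s13, s14, s15,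
      s16, s17] at h
    linear_combination (norm := skip) (1 / 3 : ℂ) • h
    match_scalars <;> grind [Complex.I_mul_I]
  have h2' : D 0 0 2 - (2 * Complex.I) • D 0 1 2 - D 1 1 2 = 0 := by
    have h := congrArg (lowering J) h1'
    simp [hL, hLJ, leviCivita, s1, s2, s3, s4, s5, s6, s7, s8, s9, s10, s11, s12, s13, s14, s15,
      s16, s17] at h
    linear_combination (norm := skip) (1 / 2 : ℂ) • h
    match_scalars <;> grind [Complex.I_mul_I]
  have hbot : D 0 0 0 - (3 * Complex.I) • D 0 0 1 - (3 : ℂ) • D 0 1 1 + Complex.I • D 1 1 1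
      = 0 := by
    have h := congrArg (lowering J) h2'
    simp [hL, leviCivita, s1, s2, s3, s4, s5, s6, s7, s8, s9, s10, s11, s12, s13, s14, s15,
      s16, s17] at h
    linear_combination (norm := skip) h
    match_scalars <;> grind [Complex.I_mul_I]
  have e022 : D 0 2 2 = (κ / 5) • J 0 := by
    linear_combination (norm := module) (1 / 2 : ℂ) • (h1 + h1')
  have e122 : D 1 2 2 = (κ / 5) • J 1 := by
    linear_combination (norm := skip) (-Complex.I / 2) • (h1 - h1')
    match_scalars <;> grind [Complex.I_mul_I]
  have e012 : D 0 1 2 = 0 := by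
    linear_combination (norm := skip) (-Complex.I / 4) • (h2 - h2')
    match_scalars <;> grind [Complex.I_mul_I]
  have e002 : D 0 0 2 = (κ / 5) • J 2 := by
    linear_combination (norm := module) (1 / 4 : ℂ) • (h2 + h2') + (1 / 2 : ℂ) • (t2 - h0)
  have e112 : D 1 1 2 = (κ / 5) • J 2 := by
    linear_combination (norm := module) (-1 / 4 : ℂ) • (h2 + h2') + (1 / 2 : ℂ) • (t2 - h0)
  have e011 : D 0 1 1 = (κ / 5) • J 0 := by
    linear_combination (norm := module)
      (-1 / 8 : ℂ) • (htop + hbot) + (1 / 4 : ℂ) • (t0 - e022)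
  have e000 : D 0 0 0 = (3 * κ / 5) • J 0 := by
    linear_combination (norm := module) t0 - e022 - e011
  have e001 : D 0 0 1 = (κ / 5) • J 1 := by
    linear_combination (norm := skip)
      (-Complex.I / 8) • (htop - hbot) + (1 / 4 : ℂ) • (t1 - e122)
    match_scalars <;> grind [Complex.I_mul_I]
  have e111 : D 1 1 1 = (3 * κ / 5) • J 1 := by
    linear_combination (norm := module) t1 - e122 - e001
  fin_cases i <;> fin_cases j <;> fin_cases k <;>
    simp [s1, s2, s3, s4, s5, s6, s7, s8, s9, s10, s11, s12, s13, s14, s15, s16, s17,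
      e000, e001, e002, e011, e012, e022, e111, e112, e122, h0] <;> module

end TensorOperator

section HighestWeight

variable {E : Type*} [Ring E] [Algebra ℂ E]

/-- The highest weight component of a rank three tensor. -/
def highest (D : Fin 3 → Fin 3 → Fin 3 → E) : E :=
  D 0 0 0 + (3 * Complex.I) • D 0 0 1 - (3 : ℂ) • D 0 1 1 - Complex.I • D 1 1 1

theorem IsTensorOperator.weight_highest {J : Fin 3 → E} {D : Fin 3 → Fin 3 → Fin 3 → E}
    (hD : IsTensorOperator J D)
    (hswap : ∀ i j k, D i j k = D j i k) (hswap' : ∀ i j k, D i j k = D i k j) :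
    J 2 * highest D - highest D * J 2 = (3 : ℂ) • highest D := by
  have h0 := hD 2 0 0 0
  have h1 := hD 2 0 0 1
  have h2 := hD 2 0 1 1
  have h3 := hD 2 1 1 1
  simp [Fin.sum_univ_three, leviCivita, hswap' 0 1 0, hswap 1 0 0, hswap 1 0 1,
    hswap' 1 1 0] at h0 h1 h2 h3
  simp only [highest, mul_add, add_mul, mul_sub, sub_mul, mul_smul_comm, smul_mul_assoc]
  linear_combination (norm := skip)
    h0 + (3 * Complex.I) • h1 - (3 : ℂ) • h2 - Complex.I • h3
  match_scalars <;> grind [Complex.I_mul_I]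

theorem IsTensorOperator.raising_highest {J : Fin 3 → E} {D : Fin 3 → Fin 3 → Fin 3 → E}
    (hD : IsTensorOperator J D)
    (hswap : ∀ i j k, D i j k = D j i k) (hswap' : ∀ i j k, D i j k = D i k j) :
    (J 0 + Complex.I • J 1) * highest D = highest D * (J 0 + Complex.I • J 1) := by
  have h0 := hD 0 0 0 0
  have h1 := hD 0 0 0 1
  have h2 := hD 0 0 1 1
  have h3 := hD 0 1 1 1
  have k0 := hD 1 0 0 0
  have k1 := hD 1 0 0 1
  have k2 := hD 1 0 1 1
  have k3 := hD 1 1 1 1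
  have s1 : D 2 0 0 = D 0 0 2 := by rw [hswap, hswap']
  have s2 : D 2 1 1 = D 1 1 2 := by rw [hswap, hswap']
  have s3 : D 2 0 1 = D 0 1 2 := by rw [hswap, hswap']
  simp [Fin.sum_univ_three, leviCivita, s1, s2, s3, hswap' 0 2 0, hswap' 0 2 1, hswap' 1 2 1]
    at h0 h1 h2 h3 k0 k1 k2 k3
  simp only [highest, mul_add, add_mul, mul_sub, sub_mul, mul_smul_comm, smul_mul_assoc]
  linear_combination (norm := skip)
    h0 + (3 * Complex.I) • h1 - (3 : ℂ) • h2 - Complex.I • h3 +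
      Complex.I • (k0 + (3 * Complex.I) • k1 - (3 : ℂ) • k2 - Complex.I • k3)
  match_scalars <;> grind [Complex.I_mul_I]

end HighestWeight

section Irreducible

variable {V : Type*} [AddCommGroup V] [Module ℂ V]

theorem Module.End.aeval_apply_of_apply_eq_smul {h : Module.End ℂ V} {x : V} {μ : ℂ}
    (hx : h x = μ • x) (P : Polynomial ℂ) : Polynomial.aeval h P x = P.eval μ • x := by
  rcases eq_or_ne x 0 with rfl | hx0
  · simp
  · exact Module.End.aeval_apply_of_hasEigenvector
      ⟨Module.End.mem_eigenspace_iff.2 hx, hx0⟩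

/-- An eigenvector in the span of eigenvectors with distinct eigenvalues is a multiple of one
of them. -/
theorem Module.End.exists_eq_smul_of_mem_span {h : Module.End ℂ V} {w : ℕ → V} {μ : ℂ}
    (hw : ∀ k : ℕ, h (w k) = (μ + k) • w k) {x : V}
    (hx : x ∈ Submodule.span ℂ (Set.range w)) {n : ℕ} (hxn : h x = (μ + n) • x) :
    ∃ c : ℂ, x = c • w n := by
  obtain ⟨c, rfl⟩ := Finsupp.mem_span_range_iff_exists_finsupp.1 hx
  set x := c.sum fun i a => a • w i with hxdef
  set P : Polynomial ℂ := ∏ k ∈ c.support.erase n, (Polynomial.X - Polynomial.C (μ + k)) with hP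
  have hPn : P.eval (μ + n) ≠ 0 := by
    rw [hP, Polynomial.eval_prod, Finset.prod_ne_zero_iff]
    intro k hk
    have : (n : ℂ) ≠ k := by exact_mod_cast (Finset.ne_of_mem_erase hk).symm
    simpa [sub_eq_zero] using this
  have h1 := Module.End.aeval_apply_of_apply_eq_smul hxn P
  have h2 : Polynomial.aeval h P x = (c n * P.eval (μ + n)) • w n := by
    rw [hxdef, Finsupp.sum, map_sum]
    simp only [map_smul, Module.End.aeval_apply_of_apply_eq_smul (hw _) P]
    rw [Finset.sum_eq_single n]
    · rw [smul_smul]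
    · intro k hk hkn
      have : P.eval (μ + k) = 0 := by
        rw [hP, Polynomial.eval_prod]
        exact Finset.prod_eq_zero (Finset.mem_erase.2 ⟨hkn, hk⟩) (by simp)
      rw [this, zero_smul, smul_zero]
    · intro hn
      rw [Finsupp.notMem_support_iff.1 hn, zero_smul]
  refine ⟨c n, ?_⟩
  have h3 := h1.symm.trans h2
  rw [mul_comm, mul_smul] at h3
  exact smul_right_injective _ hPn h3

variable [FiniteDimensional ℂ V] [Nontrivial V]

theorem IsSpin.exists_lowest {J : Fin 3 → Module.End ℂ V} (hJ : IsSpin J) :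
    ∃ (v : V) (μ : ℂ), v ≠ 0 ∧ J 2 v = μ • v ∧ (J 0 - Complex.I • J 1) v = 0 := by
  have hm : J 2 * (J 0 - Complex.I • J 1) =
      (J 0 - Complex.I • J 1) * J 2 - (J 0 - Complex.I • J 1) := by
    have h0 := hJ 2 0
    have h1 := hJ 2 1
    simp only [Fin.sum_univ_three, leviCivita] at h0 h1
    simp at h0 h1
    simp only [mul_sub, sub_mul, mul_smul_comm, smul_mul_assoc]
    linear_combination (norm := skip) h0 - Complex.I • h1
    match_scalars <;> grind [Complex.I_mul_I]
  have hfin : Set.Finite {μ : ℂ | (J 2).HasEigenvalue μ} := Module.End.finite_hasEigenvalue (J 2)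
  obtain ⟨μ, hμ, hmin⟩ := Set.exists_min_image _ Complex.re hfin
    (Module.End.exists_eigenvalue (J 2))
  obtain ⟨v, hv⟩ := Module.End.HasEigenvalue.exists_hasEigenvector hμ
  refine ⟨v, μ, hv.2, hv.apply_eq_smul, ?_⟩
  by_contra hne
  have h2 : J 2 ((J 0 - Complex.I • J 1) v) = (μ - 1) • (J 0 - Complex.I • J 1) v := by
    rw [← Module.End.mul_apply, hm, LinearMap.sub_apply, Module.End.mul_apply, hv.apply_eq_smul,
      map_smul, sub_smul, one_smul]
  have h3 := hmin (μ - 1)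
    (Module.End.hasEigenvalue_of_hasEigenvector ⟨Module.End.mem_eigenspace_iff.2 h2, hne⟩)
  simp at h3
  linarith

/-- In an irreducible spin representation, an operator of weight three commuting with the raising
operator is a multiple of the cube of the raising operator. -/
theorem IsSpin.exists_eq_smul_raising_cube {J : Fin 3 → Module.End ℂ V} (hJ : IsSpin J)
    (hirred : ∀ W : Submodule ℂ V, (∀ i : Fin 3, ∀ v ∈ W, J i v ∈ W) → W = ⊥ ∨ W = ⊤)
    {A : Module.End ℂ V}
    (hA : (J 0 + Complex.I • J 1) * A = A * (J 0 + Complex.I • J 1))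
    (hA3 : J 2 * A - A * J 2 = (3 : ℂ) • A) :
    ∃ α : ℂ, A = α • (J 0 + Complex.I • J 1) ^ 3 := by
  obtain ⟨v, μ, hv, hμ, hmv⟩ := hJ.exists_lowest
  set p := J 0 + Complex.I • J 1 with hp
  set m := J 0 - Complex.I • J 1 with hm
  have hJ01 := hJ 0 1
  have hJ20 := hJ 2 0
  have hJ21 := hJ 2 1
  simp [Fin.sum_univ_three, leviCivita] at hJ01 hJ20 hJ21
  have hhp : J 2 * p = p * J 2 + p := by
    simp only [hp, mul_add, add_mul, mul_smul_comm, smul_mul_assoc]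
    linear_combination (norm := skip) hJ20 + Complex.I • hJ21
    match_scalars <;> grind [Complex.I_mul_I]
  have hmp : m * p = p * m - (2 : ℂ) • J 2 := by
    simp only [hp, hm, mul_add, add_mul, mul_sub, sub_mul, mul_smul_comm, smul_mul_assoc]
    linear_combination (norm := skip) (2 * Complex.I) • hJ01
    match_scalars <;> grind [Complex.I_mul_I]
  have hw : ∀ k : ℕ, J 2 ((p ^ k) v) = (μ + k) • (p ^ k) v := by
    intro k
    induction k with
    | zero => simpa using hμ
    | succ k ih =>
      rw [pow_succ', Module.End.mul_apply, ← Module.End.mul_apply, hhp, LinearMap.add_apply,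
        Module.End.mul_apply, ih, map_smul]
      push_cast
      module
  set W := Submodule.span ℂ (Set.range fun k : ℕ => (p ^ k) v) with hW
  have hmem : ∀ k : ℕ, (p ^ k) v ∈ W := fun k => Submodule.subset_span ⟨k, rfl⟩
  have hinv : ∀ T : Module.End ℂ V, (∀ k : ℕ, T ((p ^ k) v) ∈ W) → ∀ x ∈ W, T x ∈ W := by
    intro T hT x hx
    have : W ≤ W.comap T := by
      rw [hW, Submodule.span_le]
      rintro _ ⟨k, rfl⟩
      exact hT k
    exact this hx
  have hpW : ∀ x ∈ W, p x ∈ W := hinv p fun k => by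
    rw [← Module.End.mul_apply, ← pow_succ']
    exact hmem _
  have hhW : ∀ x ∈ W, J 2 x ∈ W := hinv _ fun k => by
    rw [hw]
    exact W.smul_mem _ (hmem k)
  have hmW : ∀ x ∈ W, m x ∈ W := hinv m fun k => by
    induction k with
    | zero => simp [hmv]
    | succ k ih =>
      rw [pow_succ', Module.End.mul_apply, ← Module.End.mul_apply, hmp, LinearMap.sub_apply,
        Module.End.mul_apply]
      exact W.sub_mem (hpW _ ih) (W.smul_mem _ (hhW _ (hmem k)))
  have h0 : J 0 = (1 / 2 : ℂ) • (p + m) := by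
    rw [hp, hm]
    module
  have h1 : J 1 = (-Complex.I / 2) • (p - m) := by
    rw [hp, hm]
    match_scalars <;> grind [Complex.I_mul_I]
  have htop : W = ⊤ := by
    refine (hirred W fun i x hx => ?_).resolve_left fun hbot => hv ?_
    · fin_cases i
      · change J 0 x ∈ W
        rw [h0]
        exact W.smul_mem _ (W.add_mem (hpW x hx) (hmW x hx))
      · change J 1 x ∈ W
        rw [h1]
        exact W.smul_mem _ (W.sub_mem (hpW x hx) (hmW x hx))
      · exact hhW x hx
    · have := hmem 0
      rw [hbot] at this
      simpa using this
  have hAv : J 2 (A v) = (μ + (3 : ℕ)) • A v := by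
    have := congrArg (fun T : Module.End ℂ V => T v) hA3
    simp only [LinearMap.sub_apply, Module.End.mul_apply, LinearMap.smul_apply, hμ, map_smul]
      at this
    push_cast
    linear_combination (norm := module) this
  obtain ⟨α, hα⟩ := Module.End.exists_eq_smul_of_mem_span hw
    (show A v ∈ W by rw [htop]; trivial) hAv
  refine ⟨α, ?_⟩
  have hle : W ≤ LinearMap.eqLocus A (α • p ^ 3) := by
    rw [hW, Submodule.span_le]
    rintro _ ⟨k, rfl⟩
    have hc : A * p ^ k = p ^ k * A := ((show Commute p A from hA).pow_left k).symm
    change A ((p ^ k) v) = (α • p ^ 3) ((p ^ k) v)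
    rw [← Module.End.mul_apply, hc, Module.End.mul_apply, hα, map_smul, LinearMap.smul_apply,
      ← Module.End.mul_apply, ← Module.End.mul_apply, ← pow_add, ← pow_add, add_comm]
  ext x
  exact hle (show x ∈ W by rw [htop]; trivial)

/-- In an irreducible spin representation the Casimir operator is a scalar. -/
theorem IsSpin.exists_casimir {J : Fin 3 → Module.End ℂ V} (hJ : IsSpin J)
    (hirred : ∀ W : Submodule ℂ V, (∀ i : Fin 3, ∀ v ∈ W, J i v ∈ W) → W = ⊥ ∨ W = ⊤) :
    ∃ μ : ℂ, (∑ i, J i * J i).HasEigenvalue μ ∧ ∑ i, J i * J i = μ • (1 : Module.End ℂ V) := by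
  obtain ⟨μ, hμ⟩ := Module.End.exists_eigenvalue (∑ i, J i * J i)
  refine ⟨μ, hμ, ?_⟩
  have hcomm : ∀ j, (∑ i, J i * J i) * J j = J j * ∑ i, J i * J i := by
    intro j
    have key : ∀ i, J j * (J i * J i) - J i * J i * J j =
        (J j * J i - J i * J j) * J i + J i * (J j * J i - J i * J j) := by
      intro i
      noncomm_ring
    rw [eq_comm, ← sub_eq_zero, Finset.mul_sum, Finset.sum_mul, ← Finset.sum_sub_distrib]
    simp only [key, hJ j]
    fin_cases j <;> simp [Fin.sum_univ_three, leviCivita]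
  have htop : (∑ i, J i * J i).eigenspace μ = ⊤ := by
    refine (hirred _ fun j v hv => ?_).resolve_left hμ
    rw [Module.End.mem_eigenspace_iff] at hv ⊢
    rw [← Module.End.mul_apply, hcomm, Module.End.mul_apply, hv, map_smul]
  ext x
  exact Module.End.mem_eigenspace_iff.1 (htop ▸ Submodule.mem_top : x ∈ _)

end Irreducible

section SymCube

variable {E : Type*} [Ring E] [Algebra ℂ E]

theorem symCube_swap (J : Fin 3 → E) (i j k : Fin 3) : symCube J i j k = symCube J j i k := by
  simp only [symCube]
  module

theorem symCube_swap' (J : Fin 3 → E) (i j k : Fin 3) : symCube J i j k = symCube J i k j := by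
  simp only [symCube]
  module

theorem raising_cube_eq (J : Fin 3 → E) :
    (J 0 + Complex.I • J 1) ^ 3 = symCube J 0 0 0 + (3 * Complex.I) • symCube J 0 0 1 -
      (3 : ℂ) • symCube J 0 1 1 - Complex.I • symCube J 1 1 1 := by
  simp only [symCube, pow_succ, pow_zero, one_mul, mul_add, add_mul, mul_smul_comm,
    smul_mul_assoc]
  match_scalars <;> grind [Complex.I_mul_I]

theorem symCube_self (J : Fin 3 → E) (i : Fin 3) : symCube J i i i = J i ^ 3 := by
  simp only [symCube, pow_succ, pow_zero, one_mul]
  module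

theorem IsSpin.symCube_of_ne {J : Fin 3 → E} (hJ : IsSpin J) {i l : Fin 3} (h : i ≠ l) :
    symCube J i l i = J i * J l * J i + (1 / 3 : ℂ) • J l := by
  have key : J i * (J i * J l - J l * J i) - (J i * J l - J l * J i) * J i = J l := by
    rw [hJ, mul_smul_comm, smul_mul_assoc, ← smul_sub, Finset.mul_sum, Finset.sum_mul,
      ← Finset.sum_sub_distrib]
    simp only [mul_smul_comm, smul_mul_assoc, ← smul_sub, hJ i]
    fin_cases i <;> fin_cases l <;>
      first
      | exact absurd rfl h
      | simp [Fin.sum_univ_three, leviCivita, smul_smul]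
  simp only [mul_sub, sub_mul, ← mul_assoc] at key
  simp only [symCube]
  linear_combination (norm := module) (1 / 3 : ℂ) • key

theorem IsSpin.symCube_zero_one_two {J : Fin 3 → E} (hJ : IsSpin J) :
    symCube J 0 1 2 = J 0 * J 1 * J 2 +
      (1 / (2 * Complex.I)) • (J 0 ^ 2 - J 1 ^ 2 + J 2 ^ 2) := by
  have h01 := hJ 0 1
  have h12 := hJ 1 2
  have h02 := hJ 0 2
  simp [Fin.sum_univ_three, leviCivita] at h01 h12 h02
  have hinv : (1 / (2 * Complex.I)) = -Complex.I / 2 := by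
    rw [one_div, mul_inv, Complex.inv_I]
    ring
  have a1 := congrArg (fun t => J 0 * t) h12
  have a2 := congrArg (fun t => t * J 2) h01
  have a3 := congrArg (fun t => J 1 * t) h02
  have a4 := congrArg (fun t => t * J 1) h02
  have a6 := congrArg (fun t => J 2 * t) h01
  simp only [mul_sub, sub_mul, ← mul_assoc, mul_smul_comm, smul_mul_assoc, mul_neg, neg_mul]
    at a1 a2 a3 a4 a6
  rw [hinv]
  simp only [symCube, pow_two]
  linear_combination (norm := skip) (-1 / 6 : ℂ) • (a1 + a2) + (-1 / 6 : ℂ) • (a2 + a3) +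
    (-1 / 6 : ℂ) • (a1 + a4) + (-1 / 6 : ℂ) • (a1 + a4 + a6)
  match_scalars <;> grind [Complex.I_mul_I]

theorem IsSpin.sum_symCube {J : Fin 3 → E} (hJ : IsSpin J) {μ : ℂ}
    (hμ : ∑ i, J i * J i = μ • (1 : E)) (j : Fin 3) :
    ∑ i, symCube J i i j = (μ - 1 / 3) • J j := by
  have h1 : (∑ i, J i * J i) * J j = μ • J j := by rw [hμ, smul_mul_assoc, one_mul]
  have h2 : J j * (∑ i, J i * J i) = μ • J j := by rw [hμ, mul_smul_comm, mul_one]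
  have h3 : ∑ i, J i * (J j * J i - J i * J j) = -J j := by
    simp only [hJ j]
    have h01 := hJ 0 1
    have h12 := hJ 1 2
    have h02 := hJ 0 2
    simp [Fin.sum_univ_three, leviCivita] at h01 h12 h02
    fin_cases j <;> simp [Fin.sum_univ_three, leviCivita]
    · linear_combination (norm := skip) (Complex.I) • h12
      match_scalars <;> grind [Complex.I_mul_I]
    · linear_combination (norm := skip) (-Complex.I) • h02
      match_scalars <;> grind [Complex.I_mul_I]
    · linear_combination (norm := skip) (Complex.I) • h01
      match_scalars <;> grind [Complex.I_mul_I]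
  simp only [Fin.sum_univ_three, mul_add, add_mul, mul_sub, ← mul_assoc, symCube] at h1 h2 h3 ⊢
  linear_combination (norm := module) (2 / 3 : ℂ) • h1 + (1 / 3 : ℂ) • h2 + (1 / 3 : ℂ) • h3

end SymCube

section Sphere

theorem pb_add_left (f g h : MvPolynomial (Fin 3) ℝ) : pb (f + g) h = pb f h + pb g h := by
  simp only [pb, map_add]
  ring

theorem pb_add_right (f g h : MvPolynomial (Fin 3) ℝ) : pb f (g + h) = pb f g + pb f h := by
  simp only [pb, map_add]
  ring

theorem pb_mul_left (f g h : MvPolynomial (Fin 3) ℝ) :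
    pb (f * g) h = pb f h * g + f * pb g h := by
  simp only [pb, Derivation.leibniz, smul_eq_mul]
  ring

theorem pb_mul_right (f g h : MvPolynomial (Fin 3) ℝ) :
    pb f (g * h) = pb f g * h + g * pb f h := by
  simp only [pb, Derivation.leibniz, smul_eq_mul]
  ring

theorem pb_antisymm (f g : MvPolynomial (Fin 3) ℝ) : pb f g = -pb g f := by
  simp only [pb]
  ring

theorem pb_casimir_left (s : ℝ) (f : MvPolynomial (Fin 3) ℝ) :
    pb (X 0 ^ 2 + X 1 ^ 2 + X 2 ^ 2 - C (s ^ 2)) f = 0 := by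
  simp only [pb, map_add, map_sub, pow_two, Derivation.leibniz, smul_eq_mul, pderiv_C, map_mul]
  simp [pderiv_X]
  ring

theorem toSphere_eq_iff {s : ℝ} {f g : MvPolynomial (Fin 3) ℝ} :
    toSphere s f = toSphere s g ↔
      ∃ a, f = (X 0 ^ 2 + X 1 ^ 2 + X 2 ^ 2 - C (s ^ 2)) * a + g := by
  rw [toSphere, Ideal.Quotient.eq, sphereIdeal, Ideal.mem_span_singleton]
  simp only [Dvd.dvd, sub_eq_iff_eq_add]

theorem toSphere_casimir (s : ℝ) :
    toSphere s (X 0 ^ 2 + X 1 ^ 2 + X 2 ^ 2 - C (s ^ 2)) = 0 :=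
  Ideal.Quotient.eq_zero_iff_mem.2 (Ideal.mem_span_singleton_self _)

theorem toSphere_pb_congr_left {s : ℝ} {f f' : MvPolynomial (Fin 3) ℝ}
    (h : toSphere s f = toSphere s f') (g : MvPolynomial (Fin 3) ℝ) :
    toSphere s (pb f g) = toSphere s (pb f' g) := by
  obtain ⟨a, rfl⟩ := toSphere_eq_iff.1 h
  rw [pb_add_left, pb_mul_left, pb_casimir_left, zero_mul, zero_add, map_add, map_mul,
    toSphere_casimir, zero_mul, zero_add]

theorem pbS_toSphere (s : ℝ) (f g : MvPolynomial (Fin 3) ℝ) :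
    pbS s (toSphere s f) (toSphere s g) = toSphere s (pb f g) := by
  have hrep : ∀ f, toSphere s (rep s (toSphere s f)) = toSphere s f := fun f =>
    (Ideal.Quotient.mk_surjective (I := sphereIdeal s) (toSphere s f)).choose_spec
  rw [pbS, toSphere_pb_congr_left (hrep f), pb_antisymm, map_neg,
    toSphere_pb_congr_left (hrep g), ← map_neg, ← pb_antisymm]

theorem pb_X_X (m i : Fin 3) :
    pb (X m) (X i) = ∑ l, leviCivita m i l • (X l : MvPolynomial (Fin 3) ℝ) := by
  fin_cases m <;> fin_cases i <;>
    simp [pb, pderiv_X, Fin.sum_univ_three, leviCivita]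

theorem pbS_S_S (s : ℝ) (m i : Fin 3) :
    pbS s (S s m) (S s i) = ∑ l, leviCivita m i l • S s l := by
  rw [S, S, pbS_toSphere, pb_X_X, map_sum]
  simp only [map_zsmul, S]

theorem pbS_S_mul_mul (s : ℝ) (m i j k : Fin 3) :
    pbS s (S s m) (S s i * S s j * S s k) =
      ∑ l, (leviCivita m i l • (S s l * S s j * S s k) +
        leviCivita m j l • (S s i * S s l * S s k) +
        leviCivita m k l • (S s i * S s j * S s l)) := by
  simp only [S, ← map_mul, pbS_toSphere, pb_mul_right, pb_X_X]
  simp only [← map_zsmul, ← map_add, ← map_sum]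
  congr 1
  simp only [Fin.sum_univ_three, zsmul_eq_mul]
  ring

theorem sum_S_mul_S (s : ℝ) : ∑ i, S s i * S s i = algebraMap ℝ _ (s ^ 2) := by
  have h := toSphere_casimir s
  rw [map_sub, sub_eq_zero] at h
  simp only [map_add, pow_two, map_mul] at h
  rw [Fin.sum_univ_three]
  simp only [pow_two, map_mul]
  exact h

/-- The harmonic part of a cubic monomial. -/
def harmonicCube (i j k : Fin 3) : MvPolynomial (Fin 3) ℝ :=
  X i * X j * X k - C (1 / 5) * (∑ m, X m * X m) *
    ((if i = j then X k else 0) + (if j = k then X i else 0) + (if i = k then X j else 0))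

theorem harmonicCube_mem (i j k : Fin 3) : harmonicCube i j k ∈ harmonicHomog 3 := by
  have hX : ∀ m : Fin 3, (X m : MvPolynomial (Fin 3) ℝ) ∈ homogeneousSubmodule (Fin 3) ℝ 1 :=
    fun m => isHomogeneous_X _ _
  have hite : ∀ (p : Prop) [Decidable p] (m : Fin 3),
      (if p then X m else 0 : MvPolynomial (Fin 3) ℝ) ∈ homogeneousSubmodule (Fin 3) ℝ 1 := by
    intro p _ m
    split_ifs
    exacts [hX m, Submodule.zero_mem _]
  have h2 : (∑ m, X m * X m : MvPolynomial (Fin 3) ℝ).IsHomogeneous 2 :=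
    IsHomogeneous.sum _ _ _ fun m _ => (isHomogeneous_X ℝ m).mul (isHomogeneous_X ℝ m)
  have h3 : (X i * X j * X k : MvPolynomial (Fin 3) ℝ).IsHomogeneous 3 :=
    ((isHomogeneous_X _ _).mul (isHomogeneous_X _ _)).mul (isHomogeneous_X _ _)
  refine ⟨Submodule.sub_mem _ h3 (((isHomogeneous_C _ _).mul h2).mul
    (Submodule.add_mem _ (Submodule.add_mem _ (hite _ _) (hite _ _)) (hite _ _))), ?_⟩
  have h5 : (C 5⁻¹ : MvPolynomial (Fin 3) ℝ) * 5 = 1 := by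
    rw [← map_ofNat C 5, ← C_mul]
    norm_num
  fin_cases i <;> fin_cases j <;> fin_cases k <;>
    simp [harmonicCube, laplacian, Fin.sum_univ_three, pderiv_X] <;> grind

theorem S_mul_mul_mem_Otilde (s : ℝ) (i j k : Fin 3) : S s i * S s j * S s k ∈ Otilde s := by
  have h1 : toSphere s (harmonicCube i j k) ∈ Otilde s :=
    Submodule.mem_sup_right (le_iSup₂ (f := fun (l : ℕ) (_ : Odd l) => Hsph s l) 3 (by decide)
      ⟨_, harmonicCube_mem i j k, rfl⟩)
  have hite : ∀ (p : Prop) [Decidable p] (m : Fin 3),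
      (if p then S s m else 0) ∈ Otilde s := by
    intro p _ m
    split_ifs
    exacts [S_mem_Otilde s m, Submodule.zero_mem _]
  have h2 : S s i * S s j * S s k = toSphere s (harmonicCube i j k) + (s ^ 2 / 5 : ℝ) •
      ((if i = j then S s k else 0) + (if j = k then S s i else 0) +
        (if i = k then S s j else 0)) := by
    have hs := sum_S_mul_S s
    have hC : toSphere s (C (1 / 5)) = algebraMap ℝ _ (1 / 5) := rfl
    have hd : ∀ x : SpherePoly s, (s ^ 2 / 5 : ℝ) • x =
        algebraMap ℝ (SpherePoly s) (1 / 5) * algebraMap ℝ (SpherePoly s) (s ^ 2) * x := by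
      intro x
      rw [← map_mul, one_div_mul_eq_div]
      exact Algebra.smul_def (R := ℝ) (A := SpherePoly s) _ x
    simp only [harmonicCube, map_sub, map_mul, map_sum, map_add, apply_ite (toSphere s), map_zero,
      hC]
    simp only [S] at hs ⊢
    rw [hs, hd]
    ring
  rw [h2]
  exact Submodule.add_mem _ h1 (Submodule.smul_mem _ _
    (Submodule.add_mem _ (Submodule.add_mem _ (hite _ _) (hite _ _)) (hite _ _)))

end Sphere

section Quantization

variable {V : Type} [NormedAddCommGroup V] [InnerProductSpace ℂ V] [FiniteDimensional ℂ V]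

/-- The tensor `δᵢⱼ Jₖ + δⱼₖ Jᵢ + δᵢₖ Jⱼ`. -/
def deltaSpin {E : Type*} [AddMonoid E] (J : Fin 3 → E) (i j k : Fin 3) : E :=
  (if i = j then J k else 0) + (if j = k then J i else 0) + (if i = k then J j else 0)

theorem eq_re_smul_add {q X Y : Module.End ℂ V} (hq : star q = q) (hX : star X = X)
    (hY : star Y = Y) {α : ℂ} (h : q = α • X + Y) : q = (α.re : ℂ) • X + Y := by
  have h' := congrArg star h
  rw [star_add, star_smul, hq, hX, hY] at h'
  rw [Complex.re_eq_add_conj, starRingEnd_apply]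
  linear_combination (norm := module) (1 / 2 : ℂ) • h + (1 / 2 : ℂ) • h'

theorem star_symCube {J : Fin 3 → Module.End ℂ V} (hJ : ∀ i, star (J i) = J i) (i j k : Fin 3) :
    star (symCube J i j k) = symCube J i j k := by
  simp only [symCube, star_smul, star_add, star_mul, hJ, mul_assoc]
  simp
  abel

theorem star_deltaSpin {J : Fin 3 → Module.End ℂ V} (hJ : ∀ i, star (J i) = J i)
    (i j k : Fin 3) : star (deltaSpin J i j k) = deltaSpin J i j k := by
  simp only [deltaSpin, star_add, apply_ite star, star_zero, hJ]

/-- A self-adjoint symmetric rank three tensor operator on an irreducible spin representation, with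
traces `r • J`, is a real combination of the symmetrised cube of `J` and of `deltaSpin J`. -/
theorem IsTensorOperator.exists_eq_symCube [Nontrivial V] {J : Fin 3 → Module.End ℂ V}
    (hJ : IsSpin J) (hJs : ∀ i, star (J i) = J i)
    (hirred : ∀ W : Submodule ℂ V, (∀ i : Fin 3, ∀ v ∈ W, J i v ∈ W) → W = ⊥ ∨ W = ⊤)
    {q : Fin 3 → Fin 3 → Fin 3 → Module.End ℂ V} (hq : IsTensorOperator J q)
    (hqs : ∀ i j k, star (q i j k) = q i j k)
    (hswap : ∀ i j k, q i j k = q j i k) (hswap' : ∀ i j k, q i j k = q i k j)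
    (r : ℝ) (htr : ∀ j, ∑ i, q i i j = (r : ℂ) • J j) :
    ∃ a b : ℝ, ∀ i j k, q i j k = (a : ℂ) • symCube J i j k + (b : ℂ) • deltaSpin J i j k := by
  obtain ⟨μ, hμ, hcas⟩ := hJ.exists_casimir hirred
  have hsymm : (∑ i, J i * J i).IsSymmetric := by
    rw [LinearMap.isSymmetric_iff_isSelfAdjoint, isSelfAdjoint_iff, star_sum]
    simp only [star_mul, hJs]
  have hμre : ((μ.re : ℝ) : ℂ) = μ := Complex.conj_eq_iff_re.1 (hsymm.conj_eigenvalue_eq_self hμ)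
  obtain ⟨α, hα⟩ := hJ.exists_eq_smul_raising_cube hirred (hq.raising_highest hswap hswap')
    (hq.weight_highest hswap hswap')
  rw [raising_cube_eq, highest] at hα
  have hD := (hq.sub_smul hJ.isTensorOperator_symCube α).eq_of_highest_eq_zero hJ
    (fun i j k => by rw [hswap, symCube_swap]) (fun i j k => by rw [hswap', symCube_swap'])
    (r - α * (μ - 1 / 3))
    (fun j => by
      rw [Finset.sum_sub_distrib, htr, ← Finset.smul_sum, hJ.sum_symCube hcas]
      module)
    (by linear_combination (norm := module) hα)
  have hreal : ∀ i j k, q i j k = (α.re : ℂ) •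
      (symCube J i j k - (((μ.re - 1 / 3) / 5 : ℝ) : ℂ) • deltaSpin J i j k) +
        ((r / 5 : ℝ) : ℂ) • deltaSpin J i j k := by
    intro i j k
    refine eq_re_smul_add (hqs i j k) ?_ ?_ ?_
    · rw [star_sub, star_smul, star_symCube hJs, star_deltaSpin hJs]
      simp
    · rw [star_smul, star_deltaSpin hJs]
      simp
    · have h := hD i j k
      change _ = _ • deltaSpin J i j k at h
      push_cast
      rw [hμre]
      linear_combination (norm := module) h
  refine ⟨α.re, (r - α.re * (μ.re - 1 / 3)) / 5, fun i j k => ?_⟩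
  rw [hreal]
  push_cast
  module

end Quantization

/-- **Cubic von Neumann rule** (Proposition 2.7): an admissible quantization of `(Õ, P¹)`
satisfies `Q(Sᵢ³) = a Q(Sᵢ)³ + c Q(Sᵢ)`,
`Q(Sᵢ Sₗ Sᵢ) = a Q(Sᵢ)Q(Sₗ)Q(Sᵢ) + ((a+c)/3) Q(Sₗ)` for `i ≠ ℓ`, and
`Q(S₁S₂S₃) = a Q(S₁)Q(S₂)Q(S₃) + (a/(2i)) (Q(S₁)² - Q(S₂)² + Q(S₃)²)`. -/
theorem cubic_vonNeumann_rule (s : ℝ) (hs : 0 < s)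
    (V : Type) [NormedAddCommGroup V] [InnerProductSpace ℂ V]
    [FiniteDimensional ℂ V] [Nontrivial V]
    (Q : ↥(Otilde s) →ₗ[ℝ] Module.End ℂ V)
    (hselfadj : ∀ f : Otilde s, (Q f).IsSymmetric)
    (hbracket : ∀ f g h : Otilde s, (h : SpherePoly s) = pbS s f g →
      Q h = -Complex.I • (Q f * Q g - Q g * Q f))
    (hone : Q ⟨1, one_mem_Otilde s⟩ = 1)
    (hirred : ∀ W : Submodule ℂ V,
      (∀ i : Fin 3, ∀ v ∈ W, Q ⟨S s i, S_mem_Otilde s i⟩ v ∈ W) → W = ⊥ ∨ W = ⊤) :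
    ∃ a c : ℝ,
      (∀ (i : Fin 3) (h : Otilde s), (h : SpherePoly s) = S s i ^ 3 →
        Q h = (a : ℂ) • Q ⟨S s i, S_mem_Otilde s i⟩ ^ 3 +
          (c : ℂ) • Q ⟨S s i, S_mem_Otilde s i⟩) ∧
      (∀ i l : Fin 3, i ≠ l →
        ∀ h : Otilde s, (h : SpherePoly s) = S s i * S s l * S s i →
        Q h = (a : ℂ) • (Q ⟨S s i, S_mem_Otilde s i⟩ * Q ⟨S s l, S_mem_Otilde s l⟩ *
            Q ⟨S s i, S_mem_Otilde s i⟩) +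
          (((a : ℂ) + (c : ℂ)) / 3) • Q ⟨S s l, S_mem_Otilde s l⟩) ∧
      (∀ h : Otilde s, (h : SpherePoly s) = S s 0 * S s 1 * S s 2 →
        Q h = (a : ℂ) • (Q ⟨S s 0, S_mem_Otilde s 0⟩ * Q ⟨S s 1, S_mem_Otilde s 1⟩ *
            Q ⟨S s 2, S_mem_Otilde s 2⟩) +
          ((a : ℂ) / (2 * Complex.I)) •
            (Q ⟨S s 0, S_mem_Otilde s 0⟩ ^ 2 - Q ⟨S s 1, S_mem_Otilde s 1⟩ ^ 2 +
              Q ⟨S s 2, S_mem_Otilde s 2⟩ ^ 2)) := by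
  set J : Fin 3 → Module.End ℂ V := fun i => Q ⟨S s i, S_mem_Otilde s i⟩ with hJdef
  set q : Fin 3 → Fin 3 → Fin 3 → Module.End ℂ V := fun i j k =>
    Q ⟨S s i * S s j * S s k, S_mul_mul_mem_Otilde s i j k⟩ with hqdef
  have hcomm : ∀ f g h : Otilde s, (h : SpherePoly s) = pbS s f g →
      Q f * Q g - Q g * Q f = Complex.I • Q h := by
    intro f g h hh
    rw [hbracket f g h hh, smul_smul]
    simp
  have hJ : IsSpin J := by
    intro m i
    rw [hcomm ⟨S s m, S_mem_Otilde s m⟩ ⟨S s i, S_mem_Otilde s i⟩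
      (∑ l, leviCivita m i l • ⟨S s l, S_mem_Otilde s l⟩) (by simp [pbS_S_S]), map_sum]
    simp only [map_zsmul, hJdef]
  have hq : IsTensorOperator J q := by
    intro m i j k
    rw [hcomm ⟨S s m, S_mem_Otilde s m⟩ ⟨_, S_mul_mul_mem_Otilde s i j k⟩
      (∑ l, (leviCivita m i l • ⟨_, S_mul_mul_mem_Otilde s l j k⟩ +
        leviCivita m j l • ⟨_, S_mul_mul_mem_Otilde s i l k⟩ +
        leviCivita m k l • ⟨_, S_mul_mul_mem_Otilde s i j l⟩)) (by simp [pbS_S_mul_mul]), map_sum]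
    simp only [map_add, map_zsmul, hqdef]
  have hstar : ∀ f, star (Q f) = Q f := fun f =>
    (LinearMap.isSymmetric_iff_isSelfAdjoint _).1 (hselfadj f)
  have hswap : ∀ i j k, q i j k = q j i k := fun i j k => by
    simp only [hqdef, mul_comm (S s i)]
  have hswap' : ∀ i j k, q i j k = q i k j := fun i j k => by
    simp only [hqdef, mul_right_comm]
  have htr : ∀ j, ∑ i, q i i j = ((s ^ 2 : ℝ) : ℂ) • J j := by
    intro j
    have h : (∑ i, ⟨_, S_mul_mul_mem_Otilde s i i j⟩ : Otilde s) =
        (s ^ 2 : ℝ) • ⟨S s j, S_mem_Otilde s j⟩ := by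
      ext1
      rw [Submodule.coe_sum, ← Finset.sum_mul, sum_S_mul_S]
      exact (Algebra.smul_def (R := ℝ) (A := SpherePoly s) _ _).symm
    rw [← map_sum, h, map_smul]
    exact (Complex.coe_smul _ _).symm
  obtain ⟨a, b, hab⟩ := hq.exists_eq_symCube hJ (fun i => hstar _) hirred (fun i j k => hstar _)
    hswap hswap' (s ^ 2) htr
  refine ⟨a, 3 * b, fun i h hh => ?_, fun i l hil h hh => ?_, fun h hh => ?_⟩
  · obtain rfl : h = ⟨_, S_mul_mul_mem_Otilde s i i i⟩ := Subtype.ext (by rw [hh]; ring)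
    refine (hab i i i).trans ?_
    rw [symCube_self, deltaSpin]
    simp only [if_true]
    push_cast
    module
  · obtain rfl : h = ⟨_, S_mul_mul_mem_Otilde s i l i⟩ := Subtype.ext hh
    refine (hab i l i).trans ?_
    rw [hJ.symCube_of_ne hil, deltaSpin, if_neg hil, if_neg hil.symm, if_pos rfl]
    push_cast
    module
  · obtain rfl : h = ⟨_, S_mul_mul_mem_Otilde s 0 1 2⟩ := Subtype.ext hh
    refine (hab 0 1 2).trans ?_
    rw [hJ.symCube_zero_one_two, deltaSpin]
    simp only [smul_add, smul_smul, mul_one_div]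
    simp [hJdef]

end
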